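/- arXiv:1207.6672 — 2 statements merged into one kernel-verified Lean document; each statement's English description precedes it below -/
import Mathlib

section
/- If (λ, u) is a solution of the problem (φ_p(u'))' + λ a(x) φ_p(u) + f(x,u,λ) + g(x,u,λ) = 0 on (0,1), u(0) = u(1) = 0, where f satisfies (C1) and g satisfies (C2), and u has a double zero (i.e. there exists x* ∈ [0,1] with u(x*) = u'(x*) = 0), then u ≡ 0 on [0,1]. -/
open Set Filter Topology

/-- `φ_p(s) = |s|^{p-2} s`. -/
noncomputable def phip (p s : ℝ) : ℝ := |s| ^ (p - 2) * s

/-- membership in the space `E = {u ∈ C¹[0,1] : u 0 = u 1 = 0}`. -/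
def MemE (u : ℝ → ℝ) : Prop := ContDiff ℝ 1 u ∧ u 0 = 0 ∧ u 1 = 0

/-- `u` is nontrivial on `[0,1]`. -/
def Nontriv (u : ℝ → ℝ) : Prop := ∃ x ∈ Set.Icc (0:ℝ) 1, u x ≠ 0

/-- `u ∈ S_k^ν` (ν = 1 or -1): u ∈ E, exactly k-1 interior zeros in (0,1), all zeros of u in
[0,1] simple, and ν·u positive near 0. -/
def MemS (k : ℕ) (ν : ℝ) (u : ℝ → ℝ) : Prop :=
  MemE u ∧
  {x ∈ Ioo (0:ℝ) 1 | u x = 0}.Finite ∧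
  {x ∈ Ioo (0:ℝ) 1 | u x = 0}.ncard = k - 1 ∧
  (∀ x ∈ Icc (0:ℝ) 1, u x = 0 → deriv u x ≠ 0) ∧
  ∃ δ > 0, ∀ x ∈ Ioo (0:ℝ) δ, 0 < ν * u x

/-- the `C¹` norm `‖u‖ = max_{[0,1]} |u| + max_{[0,1]} |u'|` of `E`. -/
noncomputable def normE (u : ℝ → ℝ) : ℝ :=
  (⨆ x : Icc (0:ℝ) 1, |u x|) + (⨆ x : Icc (0:ℝ) 1, |deriv u x|)

/-- `u` solves `(φ_p(u'))' + λ a φ_p(u) + f(x,u,λ) + g(x,u,λ) = 0` on (0,1), u(0)=u(1)=0. -/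
def IsSolFG (p : ℝ) (a : ℝ → ℝ) (f g : ℝ → ℝ → ℝ → ℝ) (lam : ℝ) (u : ℝ → ℝ) : Prop :=
  MemE u ∧ ∀ x ∈ Set.Ioo (0:ℝ) 1,
    HasDerivAt (fun y => phip p (deriv u y))
      (-(lam * a x * phip p (u x) + f x (u x) lam + g x (u x) lam)) x

theorem abs_phip {p : ℝ} (hp : 1 < p) (s : ℝ) : |phip p s| = |s| ^ (p - 1) := by
  unfold phip
  rcases eq_or_ne s 0 with rfl | hs
  · simp [Real.zero_rpow (show p - 1 ≠ 0 by linarith)]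
  · have h := abs_pos.mpr hs
    rw [abs_mul, abs_of_nonneg (Real.rpow_nonneg h.le _), show p - 1 = (p - 2) + 1 by ring,
      Real.rpow_add h, Real.rpow_one]

theorem continuous_phip {p : ℝ} (hp : 1 < p) : Continuous (phip p) := by
  rw [continuous_iff_continuousAt]
  intro s
  rcases eq_or_ne s 0 with rfl | hs
  · have h0 : phip p 0 = 0 := by simp [phip]
    rw [ContinuousAt, h0, tendsto_zero_iff_abs_tendsto_zero]
    have h : Continuous fun s : ℝ => |s| ^ (p - 1) :=
      continuous_abs.rpow_const fun _ => Or.inr (by linarith)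
    have h' := h.tendsto 0
    simp only [abs_zero, Real.zero_rpow (show p - 1 ≠ 0 by linarith)] at h'
    exact h'.congr fun s => (abs_phip hp s).symm
  · exact (continuousAt_id.abs.rpow_const (Or.inl (by simpa using hs))).mul continuousAt_id

/-- A bound near `0`, away from `0`, by a multiple of `|s| ^ (p - 1)` extends to `s = 0` by
continuity. -/
theorem abs_le_of_forall_ne_zero {p K δ : ℝ} (hp : 1 < p) (hδ : 0 < δ) {h : ℝ → ℝ}
    (hc : Continuous h) (hb : ∀ s, 0 < |s| → |s| < δ → |h s| ≤ K * |s| ^ (p - 1))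
    {s : ℝ} (hs : |s| < δ) : |h s| ≤ K * |s| ^ (p - 1) := by
  rcases eq_or_ne s 0 with rfl | hs0
  · have hr : Continuous fun s : ℝ => K * |s| ^ (p - 1) :=
      continuous_const.mul (continuous_abs.rpow_const fun _ => Or.inr (by linarith))
    refine le_of_tendsto_of_tendsto (hc.abs.tendsto' 0 _ rfl |>.mono_left nhdsWithin_le_nhds)
      (hr.tendsto' 0 _ rfl |>.mono_left (nhdsWithin_le_nhds (s := {0}ᶜ))) ?_
    have hball : Metric.ball (0 : ℝ) δ ∈ 𝓝[≠] (0 : ℝ) :=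
      nhdsWithin_le_nhds (Metric.ball_mem_nhds 0 hδ)
    filter_upwards [hball, self_mem_nhdsWithin] with t ht ht0
    exact hb t (abs_pos.mpr ht0) (by simpa [Real.dist_eq] using ht)
  · exact hb s (abs_pos.mpr hs0) hs

theorem abs_sub_le_of_abs_hasDerivAt_le {v v' : ℝ → ℝ} {B x y : ℝ} (hv : Continuous v)
    (hd : ∀ t ∈ Ioo (min x y) (max x y), HasDerivAt v (v' t) t)
    (hb : ∀ t ∈ Ioo (min x y) (max x y), |v' t| ≤ B) : |v x - v y| ≤ B * |x - y| := by
  wlog hxy : x ≤ y generalizing x y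
  · rw [abs_sub_comm, abs_sub_comm x]
    exact this (by rwa [min_comm, max_comm]) (by rwa [min_comm, max_comm]) (le_of_not_ge hxy)
  rcases hxy.eq_or_lt with rfl | hlt
  · simp
  rw [min_eq_left hxy, max_eq_right hxy] at hd hb
  obtain ⟨c, hc, h⟩ := exists_hasDerivAt_eq_slope v v' hlt hv.continuousOn hd
  have hpos : 0 < y - x := sub_pos.mpr hlt
  have h2 : v y - v x = v' c * (y - x) := by rw [h]; field_simp
  rw [abs_sub_comm, h2, abs_mul, abs_sub_comm x]
  exact mul_le_mul_of_nonneg_right (hb c hc) (abs_nonneg _)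

/-- If `|(φ_p(u'))'| ≤ K |u|^{p-1}` wherever `u` is small, then `u` vanishes in a neighbourhood of
a double zero. -/
theorem eventually_eq_zero_of_double_zero {p K δ : ℝ} (hp : 1 < p) (hK : 0 < K) (hδ : 0 < δ)
    {u w : ℝ → ℝ} (hu : ContDiff ℝ 1 u)
    (hd : ∀ x ∈ Ioo (0 : ℝ) 1, HasDerivAt (fun y => phip p (deriv u y)) (w x) x)
    (hb : ∀ x ∈ Ioo (0 : ℝ) 1, |u x| < δ → |w x| ≤ K * |u x| ^ (p - 1))
    {x₀ : ℝ} (hx₀ : x₀ ∈ Icc (0 : ℝ) 1) (h₀ : u x₀ = 0) (h₀' : deriv u x₀ = 0) :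
    ∃ r > 0, ∀ x ∈ Icc (0 : ℝ) 1, |x - x₀| < r → u x = 0 ∧ deriv u x = 0 := by
  have hu' : Continuous (deriv u) := hu.continuous_deriv le_rfl
  obtain ⟨r₁, hr₁, hsmall⟩ :=
    Metric.continuousAt_iff.mp (hu.continuous.continuousAt (x := x₀)) δ hδ
  simp only [Real.dist_eq, h₀, sub_zero] at hsmall
  obtain ⟨r, hr, hrr₁, hr1, hrK⟩ : ∃ r > 0, r < r₁ ∧ r ≤ 1 ∧ K * r < 1 := by
    refine ⟨min (r₁ / 2) (min 1 (1 / (2 * K))), by positivity, ?_, ?_, ?_⟩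
    · exact (min_le_left _ _).trans_lt (by linarith)
    · exact (min_le_right _ _).trans (min_le_left _ _)
    · have h : min (r₁ / 2) (min 1 (1 / (2 * K))) ≤ 1 / (2 * K) :=
        (min_le_right _ _).trans (min_le_right _ _)
      calc _ ≤ K * (1 / (2 * K)) := by gcongr
        _ = 1 / 2 := by field_simp
        _ < 1 := by norm_num
  set J := Icc (max 0 (x₀ - r)) (min 1 (x₀ + r)) with hJ
  have memJ : ∀ x, x ∈ J ↔ x ∈ Icc (0 : ℝ) 1 ∧ |x - x₀| ≤ r := by
    intro x
    simp only [hJ, mem_Icc, max_le_iff, le_min_iff, abs_le]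
    constructor
    · rintro ⟨⟨_, _⟩, _, _⟩
      exact ⟨⟨‹_›, ‹_›⟩, by linarith, by linarith⟩
    · rintro ⟨⟨_, _⟩, _, _⟩
      exact ⟨⟨‹_›, by linarith⟩, ‹_›, by linarith⟩
  have hx₀J : x₀ ∈ J := (memJ _).mpr ⟨hx₀, by simpa using hr.le⟩
  obtain ⟨z, hzJ, hz⟩ := isCompact_Icc.exists_isMaxOn ⟨x₀, hx₀J⟩ hu'.abs.continuousOn
  have hsub : ∀ x ∈ J, ∀ t ∈ Ioo (min x x₀) (max x x₀), t ∈ J ∧ t ∈ Ioo (0 : ℝ) 1 := by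
    intro x hx t ht
    have hxI := ((memJ x).mp hx).1
    exact ⟨⟨(le_min hx.1 hx₀J.1).trans ht.1.le, ht.2.le.trans (max_le hx.2 hx₀J.2)⟩,
      (le_min hxI.1 hx₀.1).trans_lt ht.1, ht.2.trans_le (max_le hxI.2 hx₀.2)⟩
  have hux : ∀ x ∈ J, |u x| ≤ |deriv u z| := by
    intro x hx
    have h := abs_sub_le_of_abs_hasDerivAt_le (x := x) (y := x₀) hu.continuous
      (fun t _ => (hu.differentiable one_ne_zero t).hasDerivAt)
      (fun t ht => hz (hsub x hx t ht).1)
    rw [h₀, sub_zero] at h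
    exact h.trans (mul_le_of_le_one_right (abs_nonneg _) (((memJ x).mp hx).2.trans hr1))
  have hv := abs_sub_le_of_abs_hasDerivAt_le (x := z) (y := x₀)
    (B := K * |deriv u z| ^ (p - 1)) ((continuous_phip hp).comp hu')
    (fun t ht => hd t (hsub z hzJ t ht).2) (by
      intro t ht
      obtain ⟨htJ, htI⟩ := hsub z hzJ t ht
      refine (hb t htI (hsmall (((memJ t).mp htJ).2.trans_lt hrr₁))).trans ?_
      have := hux t htJ
      have hp1 : 0 ≤ p - 1 := by linarith
      gcongr)
  have hz0 : deriv u z = 0 := by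
    by_contra hne
    have hpos : 0 < |deriv u z| ^ (p - 1) := Real.rpow_pos_of_pos (abs_pos.mpr hne) _
    have h00 : phip p 0 = 0 := by simp [phip]
    simp only [Function.comp_apply, h₀', h00, sub_zero, abs_phip hp] at hv
    have h2 : K * |deriv u z| ^ (p - 1) * |z - x₀| ≤ K * |deriv u z| ^ (p - 1) * r := by
      have := ((memJ z).mp hzJ).2
      gcongr
    nlinarith
  refine ⟨r, hr, fun x hx hxr => ?_⟩
  have hxJ : x ∈ J := (memJ x).mpr ⟨hx, hxr.le⟩
  have h1 := hux x hxJ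
  have h2 : |deriv u x| ≤ |deriv u z| := hz hxJ
  rw [hz0, abs_zero] at h1 h2
  exact ⟨abs_nonpos_iff.mp h1, abs_nonpos_iff.mp h2⟩

/-- **Lemma 2.2**: if a solution has a double zero, it vanishes identically. -/
theorem stmt4 (p : ℝ) (hp : 1 < p)
    (a : ℝ → ℝ) (ha : ContinuousOn a (Icc 0 1)) (hapos : ∀ x ∈ Icc (0:ℝ) 1, 0 < a x)
    (f g : ℝ → ℝ → ℝ → ℝ)
    (hf : ContinuousOn (fun q : ℝ × ℝ × ℝ => f q.1 q.2.1 q.2.2)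
      (Ioo (0:ℝ) 1 ×ˢ (univ : Set (ℝ × ℝ))))
    (hg : ContinuousOn (fun q : ℝ × ℝ × ℝ => g q.1 q.2.1 q.2.2)
      (Ioo (0:ℝ) 1 ×ˢ (univ : Set (ℝ × ℝ))))
    (M : ℝ) (hM : 0 < M)
    -- (C1)
    (hC1 : ∀ x ∈ Ioo (0:ℝ) 1, ∀ s : ℝ, 0 < |s| → |s| ≤ 1 → ∀ lam : ℝ,
      |f x s lam| ≤ M * |phip p s|)
    -- (C2)
    (hC2 : ∀ C > (0:ℝ), ∀ ε > (0:ℝ), ∃ δ > (0:ℝ), ∀ x ∈ Ioo (0:ℝ) 1, ∀ s : ℝ,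
      0 < |s| → |s| < δ → ∀ lam : ℝ, |lam| ≤ C → |g x s lam| ≤ ε * |s| ^ (p - 1))
    (lam : ℝ) (u : ℝ → ℝ) (hu : IsSolFG p a f g lam u)
    -- u has a double zero
    (hdz : ∃ xs ∈ Icc (0:ℝ) 1, u xs = 0 ∧ deriv u xs = 0) :
    ∀ x ∈ Icc (0:ℝ) 1, u x = 0 := by
  obtain ⟨⟨huC, -, -⟩, hd⟩ := hu
  obtain ⟨A, hA⟩ := isCompact_Icc.exists_bound_of_continuousOn ha
  obtain ⟨δ, hδ, hgδ⟩ := hC2 (|lam| + 1) (by positivity) 1 one_pos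
  have hA0 : 0 ≤ A := (norm_nonneg _).trans (hA 0 (by simp))
  have hfg : ∀ x ∈ Ioo (0 : ℝ) 1, Continuous fun s => f x s lam + g x s lam := by
    intro x hx
    have hι : Continuous fun s : ℝ => (x, s, lam) := by fun_prop
    exact (hf.comp_continuous hι fun s => ⟨hx, mem_univ _⟩).add
      (hg.comp_continuous hι fun s => ⟨hx, mem_univ _⟩)
  have hb : ∀ x ∈ Ioo (0 : ℝ) 1, |u x| < min δ 1 →
      |-(lam * a x * phip p (u x) + f x (u x) lam + g x (u x) lam)|
        ≤ (|lam| * A + (M + 1)) * |u x| ^ (p - 1) := by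
    intro x hx hux
    have h1 : |f x (u x) lam + g x (u x) lam| ≤ (M + 1) * |u x| ^ (p - 1) := by
      refine abs_le_of_forall_ne_zero hp (lt_min hδ one_pos) (hfg x hx) (fun s hs hsδ => ?_) hux
      have h2 := hC1 x hx s hs (hsδ.trans_le (min_le_right _ _)).le lam
      have h3 := hgδ x hx s hs (hsδ.trans_le (min_le_left _ _)) lam (by linarith)
      rw [abs_phip hp] at h2
      linarith [abs_add_le (f x s lam) (g x s lam)]
    have h4 : |lam * a x * phip p (u x)| ≤ |lam| * A * |u x| ^ (p - 1) := by
      rw [abs_mul, abs_mul, abs_phip hp]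
      have : |a x| ≤ A := hA x (Ioo_subset_Icc_self hx)
      gcongr
    rw [abs_neg, add_assoc]
    linarith [abs_add_le (lam * a x * phip p (u x)) (f x (u x) lam + g x (u x) lam)]
  set Z : Set (Icc (0 : ℝ) 1) := {x | u x = 0 ∧ deriv u x = 0}
  have hclosed : IsClosed Z :=
    (isClosed_eq (huC.continuous.comp continuous_subtype_val) continuous_const).inter
      (isClosed_eq ((huC.continuous_deriv le_rfl).comp continuous_subtype_val) continuous_const)
  have hopen : IsOpen Z := by
    rw [Metric.isOpen_iff]
    rintro x ⟨hx, hx'⟩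
    obtain ⟨r, hr, h⟩ := eventually_eq_zero_of_double_zero hp (by positivity)
      (lt_min hδ one_pos) huC hd hb x.2 hx hx'
    exact ⟨r, hr, fun y hy => h y y.2 hy⟩
  obtain ⟨xs, hxs, hz⟩ := hdz
  have huniv : Z = univ := IsClopen.eq_univ ⟨hclosed, hopen⟩ ⟨⟨xs, hxs⟩, hz⟩
  intro x hx
  exact (huniv ▸ mem_univ _ : (⟨x, hx⟩ : Icc (0 : ℝ) 1) ∈ Z).1
end

section
/- Let I_* = (a,b) with I_* ⊆ (0,1) and a < b (so I_* has positive measure). Let g_n : (0,1) → ℝ be functions with g_n(x) → +∞ as n → +∞ uniformly on I_*, and for each n let y_n ∈ E be a nontrivial solution of (φ_p(y'))' + g_n(x) φ_p(y) + α(x) φ_p(y⁺) + β(x) φ_p(y⁻) = 0 on (0,1). Then the number of zeros of y_n restricted to I_* tends to infinity as n → +∞ (i.e. for every N there is n_0 such that for all n ≥ n_0 the function y_n has at least N zeros in I_*). -/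
open Set Filter Topology

theorem phip_neg (p s : ℝ) : phip p (-s) = -phip p s := by
  simp [phip]

theorem phip_mul (p s t : ℝ) : phip p (s * t) = phip p s * phip p t := by
  simp only [phip, abs_mul, Real.mul_rpow (abs_nonneg s) (abs_nonneg t)]
  ring

theorem phip_zero (p : ℝ) : phip p 0 = 0 := by
  simp [phip]

theorem phip_of_nonneg {p s : ℝ} (hp : 1 < p) (hs : 0 ≤ s) : phip p s = s ^ (p - 1) := by
  rcases hs.eq_or_lt with rfl | hs
  · rw [phip_zero, Real.zero_rpow (by linarith)]
  · rw [phip, abs_of_pos hs, ← Real.rpow_add_one hs.ne']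
    congr 1
    ring

theorem phip_strictMono {p : ℝ} (hp : 1 < p) : StrictMono (phip p) := by
  refine strictMono_of_odd_strictMonoOn_nonneg (phip_neg p) fun s hs t ht hst => ?_
  rw [phip_of_nonneg hp hs, phip_of_nonneg hp ht]
  exact Real.rpow_lt_rpow hs hst (by linarith)

theorem phip_pos {p s : ℝ} (hp : 1 < p) (hs : 0 < s) : 0 < phip p s := by
  simpa [phip_zero] using phip_strictMono hp hs

/-- A positive supersolution of `(φ_p(z'))' + K φ_p(z) = 0` that starts out nonincreasing can only
live on an interval of length `2 l` if `K l < φ_p(1 / l)`. -/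
theorem mul_lt_phip_of_pos_of_nonincreasing {p K l m : ℝ} (hp : 1 < p) (hK : 0 ≤ K) (hl : 0 < l)
    {z v F : ℝ → ℝ} (hz : ∀ x ∈ Icc m (m + 2 * l), HasDerivAt z (v x) x)
    (hv : ∀ x ∈ Icc m (m + 2 * l), HasDerivAt (fun t => phip p (v t)) (F x) x)
    (hF : ∀ x ∈ Icc m (m + 2 * l), F x ≤ -(K * phip p (z x)))
    (hpos : ∀ x ∈ Icc m (m + 2 * l), 0 < z x) (hvm : v m ≤ 0) :
    K * l < phip p l⁻¹ := by
  have hmono := phip_strictMono hp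
  have hm : m ∈ Icc m (m + 2 * l) := ⟨le_rfl, by linarith⟩
  have hml : m + l ∈ Icc m (m + 2 * l) := ⟨by linarith, by linarith⟩
  have hmll : m + 2 * l ∈ Icc m (m + 2 * l) := ⟨by linarith, le_rfl⟩
  have hvanti : AntitoneOn v (Icc m (m + 2 * l)) := by
    have h : AntitoneOn (fun t => phip p (v t)) (Icc m (m + 2 * l)) := by
      refine antitoneOn_of_hasDerivWithinAt_nonpos (convex_Icc _ _)
        (fun x hx => (hv x hx).continuousAt.continuousWithinAt)
        (fun x hx => (hv x (interior_subset hx)).hasDerivWithinAt) fun x hx => ?_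
      have hx := interior_subset hx
      have := mul_nonneg hK (phip_pos hp (hpos x hx)).le
      linarith [hF x hx]
    exact fun x hx y hy hxy => hmono.le_iff_le.1 (h hx hy hxy)
  have hzanti : AntitoneOn z (Icc m (m + 2 * l)) :=
    antitoneOn_of_hasDerivWithinAt_nonpos (convex_Icc _ _)
      (fun x hx => (hz x hx).continuousAt.continuousWithinAt)
      (fun x hx => (hz x (interior_subset hx)).hasDerivWithinAt)
      fun x hx => (hvanti hm (interior_subset hx) (interior_subset hx).1).trans hvm
  obtain ⟨ξ, hξ, hξF⟩ := exists_hasDerivAt_eq_slope (fun t => phip p (v t)) F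
    (show m < m + l by linarith)
    (fun x hx => (hv x ⟨hx.1, by linarith [hx.2]⟩).continuousAt.continuousWithinAt)
    (fun x hx => hv x ⟨hx.1.le, by linarith [hx.2]⟩)
  obtain ⟨η, hη, hηv⟩ := exists_hasDerivAt_eq_slope z v
    (show m + l < m + 2 * l by linarith)
    (fun x hx => (hz x ⟨by linarith [hx.1], hx.2⟩).continuousAt.continuousWithinAt)
    (fun x hx => hz x ⟨by linarith [hx.1], hx.2.le⟩)
  have hξ' : ξ ∈ Icc m (m + 2 * l) := ⟨hξ.1.le, by linarith [hξ.2]⟩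
  have hη' : η ∈ Icc m (m + 2 * l) := ⟨by linarith [hη.1], hη.2.le⟩
  have hzpos := phip_pos hp (hpos _ hml)
  have hupper : phip p (v (m + l)) ≤ -(K * l * phip p (z (m + l))) := by
    have h₁ : F ξ ≤ -(K * phip p (z (m + l))) := by
      have := mul_le_mul_of_nonneg_left (hmono.monotone (hzanti hξ' hml hξ.2.le)) hK
      linarith [hF ξ hξ']
    have h₂ : phip p (v m) ≤ 0 := by
      simpa [phip_zero] using hmono.monotone hvm
    rw [hξF, add_sub_cancel_left, div_le_iff₀ hl] at h₁
    linarith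
  have hlower : -(phip p l⁻¹ * phip p (z (m + l))) < phip p (v (m + l)) := by
    rw [← phip_mul, ← phip_neg]
    refine hmono (lt_of_lt_of_le ?_ (hvanti hml hη' hη.1.le))
    rw [hηv, show m + 2 * l - (m + l) = l by ring, lt_div_iff₀ hl]
    have : -(l⁻¹ * z (m + l)) * l = -z (m + l) := by
      field_simp
    linarith [hpos _ hmll]
  exact lt_of_mul_lt_mul_right (by linarith) hzpos.le

/-- A positive supersolution of `(φ_p(z'))' + K φ_p(z) = 0` can only live on an interval of length
`4 l` if `K l < φ_p(1 / l)`. -/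
theorem mul_lt_phip_of_pos {p K l c : ℝ} (hp : 1 < p) (hK : 0 ≤ K) (hl : 0 < l)
    {z v F : ℝ → ℝ} (hz : ∀ x ∈ Icc c (c + 4 * l), HasDerivAt z (v x) x)
    (hv : ∀ x ∈ Icc c (c + 4 * l), HasDerivAt (fun t => phip p (v t)) (F x) x)
    (hF : ∀ x ∈ Icc c (c + 4 * l), F x ≤ -(K * phip p (z x)))
    (hpos : ∀ x ∈ Icc c (c + 4 * l), 0 < z x) :
    K * l < phip p l⁻¹ := by
  rcases le_total (v (c + 2 * l)) 0 with h | h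
  · have hmem : ∀ x ∈ Icc (c + 2 * l) (c + 2 * l + 2 * l), x ∈ Icc c (c + 4 * l) :=
      fun x hx => ⟨by linarith [hx.1], by linarith [hx.2]⟩
    exact mul_lt_phip_of_pos_of_nonincreasing hp hK hl (fun x hx => hz x (hmem x hx))
      (fun x hx => hv x (hmem x hx)) (fun x hx => hF x (hmem x hx))
      (fun x hx => hpos x (hmem x hx)) h
  · have hmem : ∀ x ∈ Icc (-(c + 2 * l)) (-(c + 2 * l) + 2 * l), -x ∈ Icc c (c + 4 * l) :=
      fun x hx => ⟨by linarith [hx.2], by linarith [hx.1]⟩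
    refine mul_lt_phip_of_pos_of_nonincreasing (z := fun t => z (-t)) (v := fun t => -v (-t))
      (F := fun t => F (-t)) hp hK hl (fun x hx => ?_) (fun x hx => ?_)
      (fun x hx => hF _ (hmem x hx)) (fun x hx => hpos _ (hmem x hx)) (by simpa using h)
    · simpa [Function.comp_def] using (hz _ (hmem x hx)).comp x (hasDerivAt_neg x)
    · simpa [phip_neg, Function.comp_def] using ((hv _ (hmem x hx)).comp x (hasDerivAt_neg x)).fun_neg

/-- If `g` dominates `α` and `β` by a large enough constant on `[c, c + 4 l]`, every solution of the
half-linear equation has a zero there. -/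
theorem exists_zero_of_large {p K l c : ℝ} (hp : 1 < p) (hK : 0 ≤ K) (hl : 0 < l)
    (hKl : phip p l⁻¹ ≤ K * l) {g α β y : ℝ → ℝ} (hy : Differentiable ℝ y)
    (hα : ∀ x ∈ Icc c (c + 4 * l), K ≤ g x + α x) (hβ : ∀ x ∈ Icc c (c + 4 * l), K ≤ g x - β x)
    (hode : ∀ x ∈ Icc c (c + 4 * l), HasDerivAt (fun t => phip p (deriv y t))
      (-(g x * phip p (y x) + α x * phip p (max (y x) 0) + β x * phip p (-min (y x) 0))) x) :
    ∃ x ∈ Icc c (c + 4 * l), y x = 0 := by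
  by_contra! hne
  have hc : c ∈ Icc c (c + 4 * l) := ⟨le_rfl, by linarith⟩
  have hsign : (∀ x ∈ Icc c (c + 4 * l), 0 < y x) ∨ ∀ x ∈ Icc c (c + 4 * l), y x < 0 := by
    by_contra! h
    obtain ⟨⟨u, hu, hyu⟩, w, hw, hyw⟩ := h
    obtain ⟨x, hx, hx0⟩ := isPreconnected_Icc.intermediate_value hu hw
      hy.continuous.continuousOn ⟨hyu, hyw⟩
    exact hne x hx hx0
  refine hKl.not_gt ?_
  rcases hsign with h | h
  · refine mul_lt_phip_of_pos hp hK hl (fun x _ => (hy x).hasDerivAt) hode (fun x hx => ?_) h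
    rw [max_eq_left (h x hx).le, min_eq_right (h x hx).le, neg_zero, phip_zero]
    nlinarith [mul_le_mul_of_nonneg_right (hα x hx) (phip_pos hp (h x hx)).le]
  · refine mul_lt_phip_of_pos hp hK hl (z := fun t => -y t) (v := fun t => -deriv y t)
      (fun x _ => (hy x).hasDerivAt.neg)
      (fun x hx => by simpa only [phip_neg] using (hode x hx).fun_neg) (fun x hx => ?_)
      (fun x hx => neg_pos.2 (h x hx))
    have hpos := phip_pos hp (neg_pos.2 (h x hx))
    rw [max_eq_right (h x hx).le, min_eq_left (h x hx).le, phip_zero]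
    rw [phip_neg] at hpos ⊢
    nlinarith [mul_le_mul_of_nonneg_right (hβ x hx) hpos.le]

/-- **Lemma 3.2**: if `g_n → +∞` uniformly on `I_* = (a,b) ⊆ (0,1)` and `y_n ∈ E` are
nontrivial solutions of `(φ_p(y'))' + g_n φ_p(y) + α φ_p(y⁺) + β φ_p(y⁻) = 0` on (0,1),
then the number of zeros of `y_n` in `I_*` tends to infinity. -/
theorem stmt7 (p : ℝ) (hp : 1 < p)
    (α β : ℝ → ℝ) (hα : ContinuousOn α (Icc 0 1)) (hβ : ContinuousOn β (Icc 0 1))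
    (a b : ℝ) (hab : a < b) (h0a : 0 ≤ a) (hb1 : b ≤ 1)
    (g : ℕ → ℝ → ℝ)
    -- g_n → +∞ uniformly on I_*
    (hg : ∀ K : ℝ, ∃ N : ℕ, ∀ n ≥ N, ∀ x ∈ Ioo a b, K ≤ g n x)
    (y : ℕ → ℝ → ℝ)
    (hy : ∀ n : ℕ, MemE (y n) ∧ Nontriv (y n) ∧
      ∀ x ∈ Ioo (0:ℝ) 1,
        HasDerivAt (fun t => phip p (deriv (y n) t))
          (-(g n x * phip p (y n x) + α x * phip p (max (y n x) 0)
             + β x * phip p (-min (y n x) 0))) x) :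
    ∀ N : ℕ, ∃ n0 : ℕ, ∀ n ≥ n0, ∃ S : Finset ℝ,
      (↑S : Set ℝ) ⊆ {x ∈ Ioo a b | y n x = 0} ∧ N ≤ S.card := by
  intro N
  obtain ⟨A, hA⟩ := isCompact_Icc.exists_bound_of_continuousOn hα
  obtain ⟨B, hB⟩ := isCompact_Icc.exists_bound_of_continuousOn hβ
  obtain ⟨l, hl, hlN⟩ : ∃ l : ℝ, 0 < l ∧ (N + 1) * (8 * l) = b - a :=
    ⟨(b - a) / (8 * (N + 1)), by have := sub_pos.2 hab; positivity, by field_simp⟩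
  have hK : 0 ≤ phip p l⁻¹ / l := (div_pos (phip_pos hp (inv_pos.2 hl)) hl).le
  obtain ⟨n0, hn0⟩ := hg (phip p l⁻¹ / l + max A B)
  refine ⟨n0, fun n hn => ?_⟩
  obtain ⟨⟨hC1, -, -⟩, -, hode⟩ := hy n
  let c : ℕ → ℝ := fun i => a + i * (8 * l) + 2 * l
  have hmem : ∀ i < N, ∀ x ∈ Icc (c i) (c i + 4 * l), x ∈ Ioo a b := by
    intro i hi x hx
    have h₁ : 0 ≤ (i : ℝ) * (8 * l) := by positivity
    have h₂ : (i : ℝ) * (8 * l) ≤ N * (8 * l) := by gcongr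
    exact ⟨by linarith [hx.1], by linarith [hx.2]⟩
  have hsub : ∀ x ∈ Ioo a b, x ∈ Ioo (0 : ℝ) 1 :=
    fun x hx => ⟨h0a.trans_lt hx.1, hx.2.trans_le hb1⟩
  have hzero : ∀ i < N, ∃ x ∈ Icc (c i) (c i + 4 * l), y n x = 0 := by
    intro i hi
    refine exists_zero_of_large hp hK hl (div_mul_cancel₀ _ hl.ne').ge
      (hC1.differentiable (by norm_num)) (fun x hx => ?_) (fun x hx => ?_)
      fun x hx => hode x (hsub x (hmem i hi x hx))
    · have h := abs_le.1 (hA x (Ioo_subset_Icc_self (hsub x (hmem i hi x hx))))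
      linarith [hn0 n hn x (hmem i hi x hx), le_max_left A B]
    · have h := abs_le.1 (hB x (Ioo_subset_Icc_self (hsub x (hmem i hi x hx))))
      linarith [hn0 n hn x (hmem i hi x hx), le_max_right A B]
  choose! ζ hζ hζ0 using hzero
  have hlt : ∀ i < N, ∀ j < N, i < j → ζ i < ζ j := by
    intro i hi j hj hij
    have h : ((i : ℝ) + 1) * (8 * l) ≤ j * (8 * l) := by
      gcongr
      exact_mod_cast hij
    linarith [(hζ i hi).2, (hζ j hj).1]
  refine ⟨(Finset.range N).image ζ, ?_, ?_⟩
  · intro x hx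
    obtain ⟨i, hi, rfl⟩ := Finset.mem_image.1 (Finset.mem_coe.1 hx)
    have hi := Finset.mem_range.1 hi
    exact ⟨hmem i hi _ (hζ i hi), hζ0 i hi⟩
  · rw [Finset.card_image_of_injOn, Finset.card_range]
    intro i hi j hj hij
    have hi : i < N := by simpa using hi
    have hj : j < N := by simpa using hj
    rcases lt_trichotomy i j with h | h | h
    · exact absurd hij (hlt i hi j hj h).ne
    · exact h
    · exact absurd hij (hlt j hj i hi h).ne'
end
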